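/- Let G be a simple graph of order n ≥ 5 such that both G and its complement Ḡ are connected. Then 2n − 6 ≤ sdiam_{n−2}(G) + sdiam_{n−2}(Ḡ) ≤ 2n − 2 and (n − 3)² ≤ sdiam_{n−2}(G) · sdiam_{n−2}(Ḡ) ≤ (n − 1)². Moreover, if at least one of G and Ḡ has at most one cut vertex, then sdiam_{n−2}(G) + sdiam_{n−2}(Ḡ) ≤ 2n − 3 and sdiam_{n−2}(G) · sdiam_{n−2}(Ḡ) ≤ (n − 1)(n − 2). -/

import Mathlib

open SimpleGraph

/-- Steiner distance of a set of vertices `S` in `G`: the minimum number of edges of a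
connected subgraph of `G` whose vertex set contains `S`. -/
noncomputable def steinerDist {V : Type*} (G : SimpleGraph V) (S : Set V) : ℕ :=
  sInf {m | ∃ H : G.Subgraph, H.Connected ∧ S ⊆ H.verts ∧ H.edgeSet.ncard = m}

/-- Steiner `k`-diameter of `G`: the maximum Steiner distance over all `k`-element
subsets of the vertex set. -/
noncomputable def steinerDiam {V : Type*} [Fintype V] [DecidableEq V]
    (G : SimpleGraph V) (k : ℕ) : ℕ :=
  (Finset.univ.powersetCard k).sup (fun S : Finset V => steinerDist G (S : Set V))

/-- The set of cut vertices of a graph `G`: vertices whose removal disconnects `G`. -/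
def cutVertexSet {V : Type*} (G : SimpleGraph V) : Set V :=
  {v : V | ¬ (G.induce {u : V | u ≠ v}).Connected}

theorem aux_lower {V : Type*} [Fintype V] (G : SimpleGraph V) (hG : G.Connected)
    (S : Finset V) : S.card - 1 ≤ steinerDist G (S : Set V) := by
  classical
  unfold steinerDist
  have hne : {m | ∃ H : G.Subgraph, H.Connected ∧ (S : Set V) ⊆ H.verts ∧
      H.edgeSet.ncard = m}.Nonempty := by
    refine ⟨_, (⊤ : G.Subgraph), ?_, by simp, rfl⟩
    rw [Subgraph.connected_iff']
    exact (Subgraph.topIso (G := G)).connected_iff.2 hG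
  refine le_csInf hne ?_
  rintro m ⟨H, hH, hS, rfl⟩
  have h1 := hH.coe.card_vert_le_card_edgeSet_add_one
  have h2 : Nat.card H.coe.edgeSet ≤ H.edgeSet.ncard := by
    rw [← Subgraph.image_coe_edgeSet_coe, Set.ncard_image_of_injective]
    · exact le_of_eq rfl
    · exact Sym2.map.injective Subtype.val_injective
  have h3 : S.card ≤ Nat.card H.verts := by
    rw [← Set.ncard_coe_finset]
    exact Set.ncard_le_ncard hS (Set.toFinite _)
  omega

theorem aux_upper {V W : Type*} [Fintype V] [Fintype W] (G : SimpleGraph V)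
    (K : SimpleGraph W) (hK : K.Connected) (f : K →g G)
    (S : Set V) (hS : S ⊆ Set.range f) : steinerDist G S ≤ Fintype.card W - 1 := by
  classical
  obtain ⟨T, hT, hTt⟩ := hK.exists_isTree_le
  let g : T →g G := f.comp (Hom.ofLE hT)
  have hg : ∀ x, g x = f x := fun x => rfl
  let H : G.Subgraph := (⊤ : T.Subgraph).map g
  have hc : H.Connected := by
    rw [Subgraph.connected_iff']
    refine Connected.map (G := T) ⟨fun x => ⟨g x, by simp [H]⟩, ?_⟩ ?_ hTt.1
    · intro a b hab
      simp only [H, Subgraph.coe_adj, Subgraph.map_adj]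
      exact ⟨a, b, hab, rfl, rfl⟩
    · rintro ⟨y, hy⟩
      simp only [H, Subgraph.map_verts] at hy
      obtain ⟨x, -, rfl⟩ := hy
      exact ⟨x, rfl⟩
  have he : H.edgeSet.ncard ≤ Fintype.card W - 1 := by
    have h1 := hTt.card_edgeFinset
    have h2 : H.edgeSet ⊆ Sym2.map g '' T.edgeSet := by
      intro e
      induction e with
      | _ x y =>
        simp only [H, Subgraph.mem_edgeSet, Subgraph.map_adj]
        rintro ⟨a, b, hab, rfl, rfl⟩
        exact ⟨s(a, b), hab, rfl⟩
    have h3 := Set.ncard_le_ncard h2 (Set.toFinite _)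
    have h4 := Set.ncard_image_le (f := Sym2.map g) (Set.toFinite T.edgeSet)
    rw [← coe_edgeFinset, Set.ncard_coe_finset] at h4
    rw [← coe_edgeFinset] at h3
    omega
  refine le_trans (Nat.sInf_le ⟨H, hc, ?_, rfl⟩) he
  intro s hs
  obtain ⟨x, rfl⟩ := hS hs
  exact ⟨x, by simp, rfl⟩

theorem aux_diam_lower {V : Type*} [Fintype V] [DecidableEq V] (G : SimpleGraph V)
    (hG : G.Connected) (k : ℕ) (hk : k ≤ Fintype.card V) : k - 1 ≤ steinerDiam G k := by
  obtain ⟨S, -, hS⟩ := Finset.exists_subset_card_eq (s := (Finset.univ : Finset V)) hk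
  have h := aux_lower G hG S
  rw [hS] at h
  exact h.trans (Finset.le_sup (f := fun S : Finset V => steinerDist G (S : Set V))
    (Finset.mem_powersetCard.2 ⟨Finset.subset_univ _, hS⟩))

theorem aux_diam_upper {V : Type*} [Fintype V] [DecidableEq V] (G : SimpleGraph V)
    (hG : G.Connected) (k : ℕ) : steinerDiam G k ≤ Fintype.card V - 1 :=
  Finset.sup_le fun S _ => aux_upper G G hG Hom.id S fun x _ => ⟨x, rfl⟩

theorem aux_diam_cut {V : Type*} [Fintype V] [DecidableEq V] (G : SimpleGraph V)
    (h2 : 2 ≤ Fintype.card V) (hc : (cutVertexSet G).ncard ≤ 1) :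
    steinerDiam G (Fintype.card V - 2) ≤ Fintype.card V - 2 := by
  refine Finset.sup_le fun S hS => ?_
  have hS := (Finset.mem_powersetCard.1 hS).2
  have hcard : 1 < Sᶜ.card := by rw [Finset.card_compl]; omega
  obtain ⟨a, ha, b, hb, hab⟩ := Finset.one_lt_card.1 hcard
  have key : ∃ v, v ∉ S ∧ v ∉ cutVertexSet G := by
    by_contra! hcon
    exact hab ((Set.ncard_le_one (Set.toFinite _)).1 hc a (hcon a (Finset.mem_compl.1 ha))
      b (hcon b (Finset.mem_compl.1 hb)))
  obtain ⟨v, hv, hvc⟩ := key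
  have hconn : (G.induce {u : V | u ≠ v}).Connected := not_not.1 hvc
  have h := aux_upper G _ hconn (Embedding.induce {u : V | u ≠ v}).toHom (S : Set V) (by
    intro x hx
    exact ⟨⟨x, fun h => hv (h ▸ hx)⟩, rfl⟩)
  have h3 : Fintype.card {u : V | u ≠ v} = Fintype.card V - 1 := by
    simp [Set.coe_setOf]
  omega

/-- For a graph `G` of order `n ≥ 5` with `G` and `Ḡ` connected:
`2n - 6 ≤ sdiam_{n-2}(G) + sdiam_{n-2}(Ḡ) ≤ 2n - 2`,
`(n-3)² ≤ sdiam_{n-2}(G) · sdiam_{n-2}(Ḡ) ≤ (n-1)²`, and if `G` or `Ḡ` has at most one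
cut vertex, then `sdiam_{n-2}(G) + sdiam_{n-2}(Ḡ) ≤ 2n - 3` and
`sdiam_{n-2}(G) · sdiam_{n-2}(Ḡ) ≤ (n-1)(n-2)`. -/
theorem steinerDiam_sub_two_nordhaus_gaddum {V : Type*} [Fintype V] [DecidableEq V]
    (G : SimpleGraph V) (n : ℕ) (hn : Fintype.card V = n) (hn5 : 5 ≤ n)
    (hG : G.Connected) (hGc : Gᶜ.Connected) :
    (2 * n - 6 ≤ steinerDiam G (n - 2) + steinerDiam Gᶜ (n - 2) ∧
      steinerDiam G (n - 2) + steinerDiam Gᶜ (n - 2) ≤ 2 * n - 2) ∧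
    ((n - 3) ^ 2 ≤ steinerDiam G (n - 2) * steinerDiam Gᶜ (n - 2) ∧
      steinerDiam G (n - 2) * steinerDiam Gᶜ (n - 2) ≤ (n - 1) ^ 2) ∧
    ((cutVertexSet G).ncard ≤ 1 ∨ (cutVertexSet Gᶜ).ncard ≤ 1 →
      steinerDiam G (n - 2) + steinerDiam Gᶜ (n - 2) ≤ 2 * n - 3 ∧
      steinerDiam G (n - 2) * steinerDiam Gᶜ (n - 2) ≤ (n - 1) * (n - 2)) := by
  subst hn
  have a1 := aux_diam_lower G hG (Fintype.card V - 2) (by omega)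
  have a2 := aux_diam_lower Gᶜ hGc (Fintype.card V - 2) (by omega)
  have b1 := aux_diam_upper G hG (Fintype.card V - 2)
  have b2 := aux_diam_upper Gᶜ hGc (Fintype.card V - 2)
  have c1 := aux_diam_cut G (by omega)
  have c2 := aux_diam_cut Gᶜ (by omega)
  refine ⟨⟨by omega, by omega⟩, ⟨?_, ?_⟩, ?_⟩
  · rw [sq]; exact Nat.mul_le_mul (by omega) (by omega)
  · rw [sq]; exact Nat.mul_le_mul b1 b2
  · rintro (h | h)
    · have := c1 h
      refine ⟨by omega, ?_⟩
      rw [mul_comm]; exact Nat.mul_le_mul b2 this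
    · have := c2 h
      exact ⟨by omega, Nat.mul_le_mul b1 this⟩
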